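/- arXiv:2303.16545 — 11 statements merged into one kernel-verified Lean document; each statement's English description precedes it below -/
import Mathlib

section
/- Let E, F be real m×m matrices such that the pair {E,F} is a regular matrix pencil. Then there exist an integer d with 0 ≤ d ≤ m, invertible matrices L, K ∈ ℝ^{m×m}, a matrix W ∈ ℝ^{d×d}, and a nilpotent matrix N ∈ ℝ^{(m−d)×(m−d)} such that L·E·K is the block-diagonal matrix with blocks I_d and N, and L·F·K is the block-diagonal matrix with blocks W and I_{m−d}. -/
open Matrix

/-- The block-diagonal `m × m` matrix with blocks `A` (of size `d`) and `B` (of size `e`),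
where `d + e = m`. -/
def blockDiag {d e m : ℕ} (h : d + e = m)
    (A : Matrix (Fin d) (Fin d) ℝ) (B : Matrix (Fin e) (Fin e) ℝ) :
    Matrix (Fin m) (Fin m) ℝ :=
  Matrix.reindex (finSumFinEquiv.trans (finCongr h)) (finSumFinEquiv.trans (finCongr h))
    (Matrix.fromBlocks A 0 0 B)

/-- The pair `{E,F}` is a regular matrix pencil: the polynomial `λ ↦ det (λ•E + F)`
does not vanish identically. -/
def RegularPencil {m : ℕ} (E F : Matrix (Fin m) (Fin m) ℝ) : Prop :=
  ¬ ∀ c : ℝ, (c • E + F).det = 0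

lemma blockDiag_mul_blockDiag {d e m : ℕ} (h : d + e = m)
    (A C : Matrix (Fin d) (Fin d) ℝ) (B D : Matrix (Fin e) (Fin e) ℝ) :
    blockDiag h A B * blockDiag h C D = blockDiag h (A * C) (B * D) := by
  simp only [_root_.blockDiag, Matrix.reindex_apply, Matrix.submatrix_mul_equiv,
    Matrix.fromBlocks_multiply]
  simp

lemma blockDiag_one_one {d e m : ℕ} (h : d + e = m) :
    blockDiag h (1 : Matrix (Fin d) (Fin d) ℝ) (1 : Matrix (Fin e) (Fin e) ℝ) = 1 := by
  rw [_root_.blockDiag, Matrix.fromBlocks_one, Matrix.reindex_apply, Matrix.submatrix_one_equiv]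

lemma one_sub_smul_blockDiag {d e m : ℕ} (h : d + e = m) (c : ℝ)
    (A : Matrix (Fin d) (Fin d) ℝ) (B : Matrix (Fin e) (Fin e) ℝ) :
    1 - c • blockDiag h A B = blockDiag h (1 - c • A) (1 - c • B) := by
  rw [← blockDiag_one_one h]
  ext i j
  obtain ⟨i, rfl⟩ := (finSumFinEquiv.trans (finCongr h)).surjective i
  obtain ⟨j, rfl⟩ := (finSumFinEquiv.trans (finCongr h)).surjective j
  simp only [_root_.blockDiag, Matrix.sub_apply, Matrix.smul_apply, Matrix.reindex_apply,
    Matrix.submatrix_apply, Equiv.symm_apply_apply]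
  rcases i with i | i <;> rcases j with j | j <;> simp

/-- Fitting decomposition of a square matrix: it is similar to a block-diagonal matrix with an
invertible block and a nilpotent block. -/
lemma exists_conj_eq_blockDiag_isUnit_isNilpotent {m : ℕ} (G : Matrix (Fin m) (Fin m) ℝ) :
    ∃ (d e : ℕ) (h : d + e = m) (P Q : Matrix (Fin m) (Fin m) ℝ)
      (J : Matrix (Fin d) (Fin d) ℝ) (N : Matrix (Fin e) (Fin e) ℝ),
      Q * P = 1 ∧ IsUnit J ∧ IsNilpotent N ∧ Q * G * P = blockDiag h J N := by
  set f : Module.End ℝ (Fin m → ℝ) := Matrix.toLin' G with hf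
  obtain ⟨n₀, hn₀⟩ := Filter.eventually_atTop.1 (LinearMap.eventually_isCompl_ker_pow_range_pow f)
  have hc := (hn₀ (n₀ + 1) (Nat.le_succ _)).symm
  set p := LinearMap.range (f ^ (n₀ + 1))
  set q := LinearMap.ker (f ^ (n₀ + 1)) with hq
  have hcomm : ∀ x, (f ^ (n₀ + 1)) (f x) = f ((f ^ (n₀ + 1)) x) := fun x => by
    rw [← Module.End.mul_apply, ← Module.End.mul_apply, ← pow_succ, ← pow_succ']
  have hfp : ∀ x ∈ p, f x ∈ p := by
    rintro _ ⟨y, rfl⟩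
    exact ⟨f y, hcomm y⟩
  have hfq : ∀ x ∈ q, f x ∈ q := fun x hx => by
    rw [hq, LinearMap.mem_ker] at hx ⊢
    rw [hcomm, hx, map_zero]
  have hdim : Module.finrank ℝ p + Module.finrank ℝ q = m := by
    rw [Submodule.finrank_add_eq_of_isCompl hc, Module.finrank_fin_fun]
  let bp := Module.finBasis ℝ p
  let bq := Module.finBasis ℝ q
  let φ := Submodule.prodEquivOfIsCompl p q hc
  let b := ((bp.prod bq).map φ).reindex (finSumFinEquiv.trans (finCongr hdim))
  have hJ : IsUnit (f.restrict hfp) := by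
    rw [LinearMap.isUnit_iff_ker_eq_bot, LinearMap.ker_eq_bot']
    intro x hx
    have hx' : f x = 0 := by simpa using congrArg Subtype.val hx
    have : (x : Fin m → ℝ) ∈ q := by
      rw [hq, LinearMap.mem_ker, pow_succ, Module.End.mul_apply, hx', map_zero]
    exact Subtype.ext (Submodule.disjoint_def.1 hc.disjoint _ x.2 this)
  have hN : IsNilpotent (f.restrict hfq) := by
    refine ⟨n₀ + 1, ?_⟩
    rw [Module.End.pow_restrict]
    ext x : 2
    exact x.2
  refine ⟨_, _, hdim, (Pi.basisFun ℝ (Fin m)).toMatrix b, b.toMatrix (Pi.basisFun ℝ (Fin m)),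
    LinearMap.toMatrix bp bp (f.restrict hfp), LinearMap.toMatrix bq bq (f.restrict hfq),
    b.toMatrix_mul_toMatrix_flip _, hJ.map (LinearMap.toMatrixAlgEquiv bp),
    hN.map (LinearMap.toMatrixAlgEquiv bq), ?_⟩
  have hG : G = LinearMap.toMatrix (Pi.basisFun ℝ (Fin m)) (Pi.basisFun ℝ (Fin m)) f := by
    rw [LinearMap.toMatrix_eq_toMatrix', hf, LinearMap.toMatrix'_toLin']
  have hφ : ∀ z, φ.symm (f (φ z)) = (f.restrict hfp).prodMap (f.restrict hfq) z := fun z => by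
    rw [LinearEquiv.symm_apply_eq]
    simp [φ]
  conv_lhs => rw [hG]
  rw [basis_toMatrix_mul_linearMap_toMatrix_mul_basis_toMatrix, _root_.blockDiag,
    ← LinearMap.toMatrix_prodMap]
  ext i j
  simp only [b, LinearMap.toMatrix_apply, Module.Basis.reindex_apply, Module.Basis.map_apply,
    Module.Basis.repr_reindex_apply, Module.Basis.map_repr, LinearEquiv.trans_apply, hφ,
    Matrix.reindex_apply, Matrix.submatrix_apply]

/-- **Weierstraß–Kronecker form.** Every regular matrix pencil `{E,F}` admits a decomposition
`L·E·K = blockDiag (I_d, N)`, `L·F·K = blockDiag (W, I_{m-d})` with `L, K` invertible and `N`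
nilpotent. -/
theorem weierstrass_kronecker_form (m : ℕ) (E F : Matrix (Fin m) (Fin m) ℝ)
    (hreg : RegularPencil E F) :
    ∃ (d e : ℕ) (h : d + e = m) (L K : Matrix (Fin m) (Fin m) ℝ)
      (W : Matrix (Fin d) (Fin d) ℝ) (N : Matrix (Fin e) (Fin e) ℝ),
      IsUnit L.det ∧ IsUnit K.det ∧ IsNilpotent N ∧
      L * E * K = blockDiag h 1 N ∧ L * F * K = blockDiag h W 1 := by
  obtain ⟨c, hc⟩ := not_forall.1 hreg
  obtain ⟨A, hA⟩ := (Matrix.isUnit_iff_isUnit_det _).2 (isUnit_iff_ne_zero.2 hc)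
  obtain ⟨d, e, h, P, Q, J, N, hQP, ⟨J, rfl⟩, hN, hG⟩ :=
    exists_conj_eq_blockDiag_isUnit_isNilpotent (A⁻¹.val * E)
  obtain ⟨U, hU⟩ : IsUnit (1 - c • N) := (hN.smul c).isUnit_one_sub
  have hF : Q * (A⁻¹.val * F) * P = blockDiag h (1 - c • J.val) U.val := by
    have : F = A.val - c • E := by rw [hA]; abel
    rw [hU, ← one_sub_smul_blockDiag, ← hG, this, mul_sub, Units.inv_mul, mul_sub, sub_mul,
      mul_one, hQP]
    simp
  have hB : IsUnit (blockDiag h J⁻¹.val U⁻¹.val) := by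
    refine IsUnit.of_mul_eq_one (blockDiag h J.val U.val) ?_
    rw [blockDiag_mul_blockDiag, Units.inv_mul, Units.inv_mul, blockDiag_one_one]
  have hcomm : Commute U⁻¹.val N := by
    refine Commute.units_inv_left ?_
    rw [hU]
    exact (Commute.one_left N).sub_left ((Commute.refl N).smul_left c)
  refine ⟨d, e, h, blockDiag h J⁻¹.val U⁻¹.val * (Q * A⁻¹.val), P,
    J⁻¹.val * (1 - c • J.val), U⁻¹.val * N, ?_, ?_, hcomm.isNilpotent_mul_left hN, ?_, ?_⟩
  · rw [← Matrix.isUnit_iff_isUnit_det]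
    exact hB.mul ((IsUnit.of_mul_eq_one P hQP).mul A⁻¹.isUnit)
  · rw [← Matrix.isUnit_iff_isUnit_det]
    exact IsUnit.of_mul_eq_one Q (mul_eq_one_comm.1 hQP)
  · simp only [mul_assoc] at hG ⊢
    rw [hG, blockDiag_mul_blockDiag, Units.inv_mul]
  · simp only [mul_assoc] at hF ⊢
    rw [hF, blockDiag_mul_blockDiag, Units.inv_mul]
end

section
/- Let E, F be real m×m matrices forming a regular matrix pencil, and let (d, L, K, W, N) and (d̃, L̃, K̃, W̃, Ñ) be two Weierstraß–Kronecker decompositions of {E,F}. Then d = d̃, the span of the first d columns of K equals the span of the first d̃ columns of K̃, and the span of the last m−d columns of K equals the span of the last m−d̃ columns of K̃. In particular the canonical subspaces S_can and N_can are uniquely determined by the pair {E,F}. -/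
open Matrix

/-- A Weierstraß–Kronecker decomposition of the pair `{E,F}`:
`L·E·K = blockDiag (I_d, N)` and `L·F·K = blockDiag (W, I_{m-d})`, with `L, K` invertible
and `N` nilpotent. -/
structure WKDecomp (m : ℕ) (E F : Matrix (Fin m) (Fin m) ℝ) where
  d : ℕ
  e : ℕ
  hde : d + e = m
  L : Matrix (Fin m) (Fin m) ℝ
  K : Matrix (Fin m) (Fin m) ℝ
  hL : IsUnit L.det
  hK : IsUnit K.det
  W : Matrix (Fin d) (Fin d) ℝ
  N : Matrix (Fin e) (Fin e) ℝ
  hN : IsNilpotent N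
  hE : L * E * K = blockDiag hde 1 N
  hF : L * F * K = blockDiag hde W 1

variable {m : ℕ} {E F : Matrix (Fin m) (Fin m) ℝ}

/-- The canonical subspace `S_can`: the span of the first `d` columns of `K`. -/
def WKDecomp.Scan (w : WKDecomp m E F) : Submodule ℝ (Fin m → ℝ) :=
  Submodule.span ℝ
    (Set.range fun j : Fin w.d => w.K.transpose (finCongr w.hde (Fin.castAdd w.e j)))

/-- The canonical subspace `N_can`: the span of the last `m - d` columns of `K`. -/
def WKDecomp.Ncan (w : WKDecomp m E F) : Submodule ℝ (Fin m → ℝ) :=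
  Submodule.span ℝ
    (Set.range fun j : Fin w.e => w.K.transpose (finCongr w.hde (Fin.natAdd w.d j)))

lemma blockDiag_mul {d e m : ℕ} (h : d + e = m) (A A' : Matrix (Fin d) (Fin d) ℝ)
    (B B' : Matrix (Fin e) (Fin e) ℝ) :
    blockDiag h A B * blockDiag h A' B' = blockDiag h (A * A') (B * B') := by
  simp only [_root_.blockDiag, Matrix.reindex_apply, Matrix.submatrix_mul_equiv,
    Matrix.fromBlocks_multiply]
  simp

lemma blockDiag_one {d e m : ℕ} (h : d + e = m) : blockDiag h 1 1 = 1 := by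
  rw [_root_.blockDiag, Matrix.fromBlocks_one, Matrix.reindex_apply, Matrix.submatrix_one_equiv]

lemma blockDiag_pow {d e m : ℕ} (h : d + e = m) (A : Matrix (Fin d) (Fin d) ℝ)
    (B : Matrix (Fin e) (Fin e) ℝ) (n : ℕ) :
    blockDiag h A B ^ n = blockDiag h (A ^ n) (B ^ n) := by
  induction n with
  | zero => simp [blockDiag_one]
  | succ n ih => rw [pow_succ, ih, blockDiag_mul, ← pow_succ, ← pow_succ]

lemma smul_blockDiag_add {d e m : ℕ} (h : d + e = m) (c : ℝ)
    (A A' : Matrix (Fin d) (Fin d) ℝ) (B B' : Matrix (Fin e) (Fin e) ℝ) :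
    c • blockDiag h A B + blockDiag h A' B' = blockDiag h (c • A + A') (c • B + B') := by
  subst h
  ext i j
  induction i using Fin.addCases <;> induction j using Fin.addCases <;> simp [_root_.blockDiag]

lemma mul_blockDiag_one_zero_transpose {d e m : ℕ} (h : d + e = m)
    (K : Matrix (Fin m) (Fin m) ℝ) :
    (∀ j, (K * blockDiag h 1 0)ᵀ (finCongr h (Fin.castAdd e j)) =
      Kᵀ (finCongr h (Fin.castAdd e j))) ∧
    ∀ j, (K * blockDiag h 1 0)ᵀ (finCongr h (Fin.natAdd d j)) = 0 := by
  subst h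
  constructor <;> intro j <;> ext i <;>
    simp [_root_.blockDiag, Matrix.mul_apply, Fin.sum_univ_add, Matrix.one_apply]

lemma mul_blockDiag_zero_one_transpose {d e m : ℕ} (h : d + e = m)
    (K : Matrix (Fin m) (Fin m) ℝ) (j : Fin e) :
    (K * blockDiag h 0 1)ᵀ (finCongr h (Fin.natAdd d j)) =
      Kᵀ (finCongr h (Fin.natAdd d j)) := by
  subst h
  ext i
  simp [_root_.blockDiag, Matrix.mul_apply, Fin.sum_univ_add, Matrix.one_apply]

lemma WKDecomp.linearIndependent_transpose (w : WKDecomp m E F) :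
    LinearIndependent ℝ fun j => w.Kᵀ j :=
  Matrix.linearIndependent_cols_of_isUnit ((Matrix.isUnit_iff_isUnit_det _).2 w.hK)

lemma WKDecomp.finrank_Scan (w : WKDecomp m E F) : Module.finrank ℝ w.Scan = w.d := by
  have := finrank_span_eq_card (w.linearIndependent_transpose.comp
    (fun j => finCongr w.hde (Fin.castAdd w.e j))
    ((finCongr w.hde).injective.comp (Fin.castAdd_injective _ _)))
  rwa [Fintype.card_fin] at this

lemma WKDecomp.finrank_Ncan (w : WKDecomp m E F) : Module.finrank ℝ w.Ncan = w.e := by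
  have := finrank_span_eq_card (w.linearIndependent_transpose.comp
    (fun j => finCongr w.hde (Fin.natAdd w.d j))
    ((finCongr w.hde).injective.comp (Fin.natAdd_injective _ _)))
  rwa [Fintype.card_fin] at this

/-- The range of `K * blockDiag 1 0` is the span of the first columns of `K`. -/
lemma WKDecomp.range_mul_blockDiag (w : WKDecomp m E F) :
    LinearMap.range (w.K * blockDiag w.hde 1 0).mulVecLin = w.Scan := by
  obtain ⟨h₁, h₂⟩ := mul_blockDiag_one_zero_transpose w.hde w.K
  rw [Matrix.range_mulVecLin]
  apply le_antisymm <;> refine Submodule.span_le.2 ?_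
  · rintro _ ⟨j, rfl⟩
    obtain ⟨j, rfl⟩ := (finCongr w.hde).surjective j
    induction j using Fin.addCases with
    | left j => exact (congrArg (· ∈ w.Scan) (h₁ j)).mpr (Submodule.subset_span ⟨j, rfl⟩)
    | right j => exact (congrArg (· ∈ w.Scan) (h₂ j)).mpr w.Scan.zero_mem
  · rintro _ ⟨j, rfl⟩
    exact Submodule.subset_span ⟨_, h₁ j⟩

/-- The powers of `(c • E + F)⁻¹ * E` in the basis given by the columns of `K`. -/
lemma WKDecomp.exists_pow_mul_eq (w : WKDecomp m E F) {c : ℝ} (hc : (c • E + F).det ≠ 0) (n : ℕ)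
    (hn : w.N ^ n = 0) :
    ∃ A B, IsUnit (blockDiag w.hde A B).det ∧
      ((c • E + F)⁻¹ * E) ^ n * w.K * blockDiag w.hde A B = w.K * blockDiag w.hde 1 0 := by
  set M := c • E + F with hM
  set D := blockDiag w.hde (c • 1 + w.W) (c • w.N + 1) with hD
  set B := blockDiag w.hde 1 w.N with hB
  have hLMK : w.L * M * w.K = D := by
    rw [hD, ← smul_blockDiag_add, ← w.hE, ← w.hF, hM]
    simp [mul_add, add_mul]
  have hMdet : IsUnit M.det := hc.isUnit
  have hDdet : IsUnit D.det := by
    rw [← hLMK, Matrix.det_mul, Matrix.det_mul]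
    exact (w.hL.mul hMdet).mul w.hK
  have hcomm : Commute B D := by
    simp only [Commute, SemiconjBy, hB, hD, blockDiag_mul]
    congr 1 <;> simp [mul_add, add_mul]
  have hEK : E * w.K = w.L⁻¹ * B := by
    rw [hB, ← w.hE, mul_assoc w.L, Matrix.nonsing_inv_mul_cancel_left _ _ w.hL]
  have hMK : M * w.K = w.L⁻¹ * D := by
    rw [← hLMK, mul_assoc w.L, Matrix.nonsing_inv_mul_cancel_left _ _ w.hL]
  have hstep : M⁻¹ * E * w.K * D = w.K * B := by
    rw [mul_assoc M⁻¹, hEK, mul_assoc, mul_assoc, hcomm.eq, ← mul_assoc w.L⁻¹, ← hMK, mul_assoc M,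
      Matrix.nonsing_inv_mul_cancel_left _ _ hMdet]
  have hpow : ∀ k, (M⁻¹ * E) ^ k * w.K * D ^ k = w.K * B ^ k := by
    intro k
    induction k with
    | zero => simp
    | succ k ih =>
      calc (M⁻¹ * E) ^ (k + 1) * w.K * D ^ (k + 1)
          = (M⁻¹ * E) ^ k * (M⁻¹ * E * w.K * D) * D ^ k := by
            rw [pow_succ, pow_succ']; simp only [mul_assoc]
        _ = (M⁻¹ * E) ^ k * w.K * (B * D ^ k) := by rw [hstep]; simp only [mul_assoc]
        _ = w.K * B ^ (k + 1) := by
            rw [(hcomm.pow_right k).eq, ← mul_assoc, ih, mul_assoc, ← pow_succ]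
  refine ⟨(c • 1 + w.W) ^ n, (c • w.N + 1) ^ n, ?_, ?_⟩
  · rw [← blockDiag_pow, ← hD, Matrix.det_pow]
    exact hDdet.pow n
  · rw [← blockDiag_pow, ← hD, hpow, hB, blockDiag_pow, one_pow, hn]

/-- The canonical subspaces are the Fitting components of `(c • E + F)⁻¹ * E`. -/
lemma WKDecomp.range_ker_pow (w : WKDecomp m E F) {c : ℝ} (hc : (c • E + F).det ≠ 0) (n : ℕ)
    (hn : w.N ^ n = 0) :
    w.Scan = LinearMap.range (((c • E + F)⁻¹ * E) ^ n).mulVecLin ∧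
      w.Ncan = LinearMap.ker (((c • E + F)⁻¹ * E) ^ n).mulVecLin := by
  obtain ⟨A, B, hdet, h⟩ := w.exists_pow_mul_eq hc n hn
  set R := ((c • E + F)⁻¹ * E) ^ n
  have hrange : w.Scan = LinearMap.range R.mulVecLin := by
    have hsurj : Function.Surjective (w.K * blockDiag w.hde A B).mulVecLin := by
      refine Matrix.mulVec_surjective_iff_isUnit.2 ((Matrix.isUnit_iff_isUnit_det _).2 ?_)
      rw [Matrix.det_mul]
      exact w.hK.mul hdet
    rw [← w.range_mul_blockDiag, ← h, mul_assoc, Matrix.mulVecLin_mul,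
      LinearMap.range_comp_of_range_eq_top _ (LinearMap.range_eq_top.2 hsurj)]
  refine ⟨hrange, Submodule.eq_of_le_of_finrank_eq ?_ ?_⟩
  · have hzero : R * (w.K * blockDiag w.hde 0 1) = 0 := by
      have : R * (w.K * blockDiag w.hde 0 1) * blockDiag w.hde A B = 0 := by
        calc R * (w.K * blockDiag w.hde 0 1) * blockDiag w.hde A B
            = R * w.K * blockDiag w.hde A B * blockDiag w.hde 0 1 := by
              simp only [mul_assoc, blockDiag_mul, zero_mul, mul_zero, one_mul, mul_one]
          _ = 0 := by
              rw [h, mul_assoc, blockDiag_mul]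
              simp [_root_.blockDiag]
      rw [← Matrix.mul_nonsing_inv_cancel_right _ (R * (w.K * blockDiag w.hde 0 1)) hdet, this,
        zero_mul]
    refine Submodule.span_le.2 ?_
    rintro _ ⟨j, rfl⟩
    simp only [SetLike.mem_coe, LinearMap.mem_ker, Matrix.mulVecLin_apply]
    rw [← mul_blockDiag_zero_one_transpose w.hde w.K j]
    ext i
    exact congrFun (congrFun hzero i) (finCongr w.hde (Fin.natAdd w.d j))
  · have := R.mulVecLin.finrank_range_add_finrank_ker
    rw [← hrange, w.finrank_Scan, Module.finrank_fin_fun] at this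
    have := w.hde
    rw [w.finrank_Ncan]
    omega

/-- For a regular matrix pencil, any two Weierstraß–Kronecker decompositions share the same
value of `d`, the same span of the first `d` columns of `K` (the canonical subspace `S_can`),
and the same span of the last `m - d` columns of `K` (the canonical subspace `N_can`). -/
theorem canonical_subspaces_unique (m : ℕ) (E F : Matrix (Fin m) (Fin m) ℝ)
    (hreg : RegularPencil E F) (w w' : WKDecomp m E F) :
    w.d = w'.d ∧ w.Scan = w'.Scan ∧ w.Ncan = w'.Ncan := by
  obtain ⟨c, hc⟩ := not_forall.1 hreg
  obtain ⟨p, hp⟩ := w.hN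
  obtain ⟨q, hq⟩ := w'.hN
  obtain ⟨hS, hN⟩ := w.range_ker_pow hc (p + q) (by rw [pow_add, hp, zero_mul])
  obtain ⟨hS', hN'⟩ := w'.range_ker_pow hc (p + q) (by rw [pow_add, hq, mul_zero])
  have hScan : w.Scan = w'.Scan := hS.trans hS'.symm
  refine ⟨?_, hScan, hN.trans hN'.symm⟩
  rw [← w.finrank_Scan, hScan, w'.finrank_Scan]
end

section
/- Let E, F be real m×m matrices forming a regular matrix pencil with Weierstraß–Kronecker decomposition (d, L, K, W, N), and let S_can and N_can be the associated canonical subspaces. Then the matrix Π := K · blockDiag(I_d, 0) · K⁻¹ satisfies Π·Π = Π, the column space of Π equals S_can, the kernel of Π equals N_can, and ℝ^m is the (internal) direct sum S_can ⊕ N_can, i.e. S_can ∩ N_can = {0} and S_can + N_can = ℝ^m. -/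
open Matrix

variable {m : ℕ} {E F : Matrix (Fin m) (Fin m) ℝ}

theorem LinearMap.idempotent_range_ker_of_sup_eq_top {R V : Type*} [Ring R] [AddCommGroup V]
    [Module R V] (f : V →ₗ[R] V) (S T : Submodule R V) (hS : ∀ x ∈ S, f x = x)
    (hT : ∀ x ∈ T, f x = 0) (hST : S ⊔ T = ⊤) :
    (∀ x, f (f x) = f x) ∧ LinearMap.range f = S ∧ LinearMap.ker f = T ∧ S ⊓ T = ⊥ := by
  have hdec : ∀ x, ∃ s ∈ S, ∃ t ∈ T, s + t = x := fun x =>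
    Submodule.mem_sup.mp (hST ▸ Submodule.mem_top)
  refine ⟨fun x => ?_, ?_, ?_, ?_⟩
  · obtain ⟨s, hs, t, ht, rfl⟩ := hdec x
    simp [hS s hs, hT t ht]
  · refine le_antisymm ?_ fun x hx => ⟨x, hS x hx⟩
    rintro _ ⟨x, rfl⟩
    obtain ⟨s, hs, t, ht, rfl⟩ := hdec x
    simpa [hS s hs, hT t ht] using hs
  · refine le_antisymm (fun x hx => ?_) fun x hx => hT x hx
    obtain ⟨s, hs, t, ht, rfl⟩ := hdec x
    have h0 : s = 0 := by simpa [hS s hs, hT t ht] using hx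
    simpa [h0] using ht
  · refine (Submodule.eq_bot_iff _).mpr fun x hx => ?_
    rw [← hS x hx.1, hT x hx.2]

theorem blockDiag_one_zero_mulVec_castAdd {d e m : ℕ} (h : d + e = m) (j : Fin d) :
    _root_.blockDiag h 1 0 *ᵥ Pi.single (finCongr h (Fin.castAdd e j)) 1 =
      Pi.single (finCongr h (Fin.castAdd e j)) 1 := by
  subst h
  ext i
  induction i using Fin.addCases with
  | left i => simp [_root_.blockDiag, Matrix.one_apply, Pi.single_apply]
  | right i =>
    have hne : Fin.natAdd d i ≠ Fin.castAdd e j := by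
      simp only [ne_eq, Fin.ext_iff, Fin.val_natAdd, Fin.val_castAdd]
      omega
    simp [_root_.blockDiag, hne]

theorem blockDiag_one_zero_mulVec_natAdd {d e m : ℕ} (h : d + e = m) (j : Fin e) :
    _root_.blockDiag h 1 0 *ᵥ Pi.single (finCongr h (Fin.natAdd d j)) 1 = 0 := by
  subst h
  ext i
  induction i using Fin.addCases <;> simp [_root_.blockDiag]

theorem WKDecomp.conj_mulVec_col (w : WKDecomp m E F) (D : Matrix (Fin m) (Fin m) ℝ)
    (j : Fin m) :
    (w.K * D * w.K⁻¹) *ᵥ w.K.transpose j = w.K *ᵥ (D *ᵥ Pi.single j 1) := by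
  have hcol : w.K.transpose j = w.K *ᵥ Pi.single j 1 := (Matrix.mulVec_single_one _ _).symm
  rw [hcol, Matrix.mulVec_mulVec, Matrix.mul_assoc, Matrix.nonsing_inv_mul _ w.hK,
    Matrix.mul_one, Matrix.mulVec_mulVec]

theorem WKDecomp.Scan_sup_Ncan (w : WKDecomp m E F) : w.Scan ⊔ w.Ncan = ⊤ := by
  have hcol : ∀ j, w.K.transpose j ∈ w.Scan ⊔ w.Ncan := by
    intro j
    obtain ⟨i, rfl⟩ := (finCongr w.hde).surjective j
    induction i using Fin.addCases with
    | left i => exact Submodule.mem_sup_left (Submodule.subset_span ⟨i, rfl⟩)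
    | right i => exact Submodule.mem_sup_right (Submodule.subset_span ⟨i, rfl⟩)
  refine eq_top_iff.mpr fun x _ => ?_
  have hx : w.K *ᵥ (w.K⁻¹ *ᵥ x) = x := by
    rw [Matrix.mulVec_mulVec, Matrix.mul_nonsing_inv _ w.hK, Matrix.one_mulVec]
  rw [← hx, Matrix.mulVec_eq_sum]
  simp only [op_smul_eq_smul]
  exact Submodule.sum_mem _ fun j _ => Submodule.smul_mem _ _ (hcol j)

/-- The spectral (canonical) projector `Π = K · blockDiag(I_d, 0) · K⁻¹` of a regular pencil
is idempotent, has column space `S_can` and kernel `N_can`, and `ℝ^m = S_can ⊕ N_can`. -/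
theorem spectral_projector (m : ℕ) (E F : Matrix (Fin m) (Fin m) ℝ)
    (hreg : RegularPencil E F) (w : WKDecomp m E F)
    (P : Matrix (Fin m) (Fin m) ℝ)
    (hP : P = w.K * blockDiag w.hde (1 : Matrix (Fin w.d) (Fin w.d) ℝ)
      (0 : Matrix (Fin w.e) (Fin w.e) ℝ) * w.K⁻¹) :
    P * P = P ∧
    LinearMap.range P.mulVecLin = w.Scan ∧
    LinearMap.ker P.mulVecLin = w.Ncan ∧
    w.Scan ⊓ w.Ncan = ⊥ ∧
    w.Scan ⊔ w.Ncan = ⊤ := by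
  have hS : ∀ x ∈ w.Scan, P.mulVecLin x = x := by
    intro x hx
    refine LinearMap.eqOn_span (g := LinearMap.id) ?_ hx
    rintro _ ⟨j, rfl⟩
    rw [Matrix.mulVecLin_apply, hP, w.conj_mulVec_col, blockDiag_one_zero_mulVec_castAdd,
      Matrix.mulVec_single_one]
    rfl
  have hN : ∀ x ∈ w.Ncan, P.mulVecLin x = 0 := by
    intro x hx
    refine LinearMap.eqOn_span (g := 0) ?_ hx
    rintro _ ⟨j, rfl⟩
    rw [Matrix.mulVecLin_apply, hP, w.conj_mulVec_col, blockDiag_one_zero_mulVec_natAdd,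
      Matrix.mulVec_zero]
    rfl
  obtain ⟨hidem, hrange, hker, hinf⟩ :=
    P.mulVecLin.idempotent_range_ker_of_sup_eq_top _ _ hS hN w.Scan_sup_Ncan
  refine ⟨?_, hrange, hker, hinf, w.Scan_sup_Ncan⟩
  refine Matrix.ext_of_mulVec_single fun i => ?_
  rw [← Matrix.mulVec_mulVec]
  exact hidem _
end

section
/- Let E, F be real m×m matrices forming a regular matrix pencil with Weierstraß–Kronecker decomposition (d, L, K, W, N). Then the kernel of E (the subspace {z ∈ ℝ^m : E·z = 0}) is contained in the canonical subspace N_can. -/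
open Matrix

variable {m : ℕ} {E F : Matrix (Fin m) (Fin m) ℝ}

/-- The leading coordinates of `blockDiag h A B *ᵥ y` are `A` applied to those of `y`. -/
theorem blockDiag_mulVec_castAdd {d e m : ℕ} (h : d + e = m)
    (A : Matrix (Fin d) (Fin d) ℝ) (B : Matrix (Fin e) (Fin e) ℝ) (y : Fin m → ℝ) (i : Fin d) :
    (blockDiag h A B *ᵥ y) (finCongr h (Fin.castAdd e i)) =
      (A *ᵥ fun j => y (finCongr h (Fin.castAdd e j))) i := by
  subst h
  simp [_root_.blockDiag, Matrix.mulVec, dotProduct, Fin.sum_univ_add]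

/-- A vector with vanishing leading coordinates is mapped by `K` into `N_can`. -/
theorem WKDecomp.mulVec_mem_Ncan {m : ℕ} {E F : Matrix (Fin m) (Fin m) ℝ} (w : WKDecomp m E F)
    (y : Fin m → ℝ) (hy : ∀ i : Fin w.d, y (finCongr w.hde (Fin.castAdd w.e i)) = 0) :
    w.K *ᵥ y ∈ w.Ncan := by
  rw [Matrix.mulVec_eq_sum, ← (finCongr w.hde).sum_comp, Fin.sum_univ_add]
  refine add_mem (sum_mem fun i _ => by rw [hy]; simp) (sum_mem fun j _ => ?_)
  rw [op_smul_eq_smul]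
  exact Submodule.smul_mem _ _ (Submodule.subset_span ⟨j, rfl⟩)

/-- For a regular matrix pencil with Weierstraß–Kronecker decomposition,
the kernel of `E` is contained in the canonical subspace `N_can`. -/
theorem ker_le_Ncan (m : ℕ) (E F : Matrix (Fin m) (Fin m) ℝ)
    (hreg : RegularPencil E F) (w : WKDecomp m E F) :
    LinearMap.ker E.mulVecLin ≤ w.Ncan := by
  intro z hz
  have hEz : E *ᵥ z = 0 := by simpa using hz
  have hKz : w.K *ᵥ (w.K⁻¹ *ᵥ z) = z := by
    rw [Matrix.mulVec_mulVec, Matrix.mul_nonsing_inv _ w.hK, Matrix.one_mulVec]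
  have hblock : blockDiag w.hde 1 w.N *ᵥ (w.K⁻¹ *ᵥ z) = 0 := by
    rw [← w.hE, ← Matrix.mulVec_mulVec, hKz, ← Matrix.mulVec_mulVec, hEz, Matrix.mulVec_zero]
  rw [← hKz]
  refine w.mulVec_mem_Ncan _ fun i => ?_
  have hi := blockDiag_mulVec_castAdd w.hde 1 w.N (w.K⁻¹ *ᵥ z) i
  rw [hblock, Matrix.one_mulVec] at hi
  exact hi.symm
end

section
/- Let N be a nilpotent real n×n matrix and let v : ℝ → ℝ^n be differentiable with N·v'(t) + v(t) = 0 for all t ∈ ℝ. Then v is identically zero. -/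
open Matrix

theorem HasDerivAt.matrix_mulVec {m n : Type*} [Fintype m] [Fintype n] (A : Matrix m n ℝ)
    {v : ℝ → n → ℝ} {v' : n → ℝ} {t : ℝ} (hv : HasDerivAt v v' t) :
    HasDerivAt (fun s => A *ᵥ v s) (A *ᵥ v') t :=
  (LinearMap.toContinuousLinearMap A.mulVecLin).hasFDerivAt.comp_hasDerivAt t hv

/-- If `N` is a nilpotent matrix and `v` is a differentiable function satisfying
`N·v'(t) + v(t) = 0` for all `t`, then `v` is identically zero. -/
theorem nilpotent_dae_homogeneous_zero (n : ℕ) (N : Matrix (Fin n) (Fin n) ℝ)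
    (hN : IsNilpotent N) (v : ℝ → Fin n → ℝ) (hv : Differentiable ℝ v)
    (hsol : ∀ t : ℝ, N.mulVec (deriv v t) + v t = 0) :
    ∀ t : ℝ, v t = 0 := by
  obtain ⟨k, hk⟩ := hN
  have descend (j : ℕ) (hj : ∀ t, (N ^ (j + 1)) *ᵥ v t = 0) (t : ℝ) : (N ^ j) *ᵥ v t = 0 := by
    have hderiv : (N ^ (j + 1)) *ᵥ deriv v t = 0 := by
      have h := (hv t).hasDerivAt.matrix_mulVec (N ^ (j + 1))
      simp only [hj] at h
      exact h.unique (hasDerivAt_const t 0)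
    rw [eq_neg_of_add_eq_zero_right (hsol t), mulVec_neg, mulVec_mulVec, ← pow_succ, hderiv,
      neg_zero]
  have vanish (j : ℕ) (hj : ∀ t, (N ^ j) *ᵥ v t = 0) : ∀ t, v t = 0 := by
    induction j with
    | zero => simpa using hj
    | succ j ih => exact ih (descend j hj)
  exact vanish k fun t => by rw [hk, zero_mulVec]
end

section
/- Let N be a real n×n matrix with N^μ = 0 for some μ ≥ 1, and let g : ℝ → ℝ^n be μ-times continuously differentiable (of class C^μ). Then the function v(t) := Σ_{j=0}^{μ−1} (−1)^j · N^j · g^{(j)}(t) is differentiable and satisfies N·v'(t) + v(t) = g(t) for all t ∈ ℝ; moreover, v is the unique differentiable function ℝ → ℝ^n with this property. -/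
open Matrix

theorem HasDerivAt.const_mulVec {m n : ℕ} (A : Matrix (Fin m) (Fin n) ℝ)
    {f : ℝ → Fin n → ℝ} {f' : Fin n → ℝ} {t : ℝ} (hf : HasDerivAt f f' t) :
    HasDerivAt (fun s => A *ᵥ f s) (A *ᵥ f') t :=
  (LinearMap.toContinuousLinearMap A.mulVecLin).hasFDerivAt.comp_hasDerivAt t hf

/-- A nilpotent homogeneous equation `N u' + u = 0` has only the trivial solution. -/
theorem eq_zero_of_nilpotent_mulVec_deriv_add {n μ : ℕ} {N : Matrix (Fin n) (Fin n) ℝ}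
    (hN : N ^ μ = 0) {u : ℝ → Fin n → ℝ} (hu : Differentiable ℝ u)
    (h : ∀ t, N *ᵥ deriv u t + u t = 0) (t : ℝ) : u t = 0 := by
  have step : ∀ k, (∀ s, (N ^ (k + 1)) *ᵥ u s = 0) → ∀ s, (N ^ k) *ᵥ u s = 0 := by
    intro k hk s
    have hd : HasDerivAt (fun s => (N ^ (k + 1)) *ᵥ u s) ((N ^ (k + 1)) *ᵥ deriv u s) s :=
      (hu s).hasDerivAt.const_mulVec _
    rw [funext hk] at hd
    have hz : (N ^ (k + 1)) *ᵥ deriv u s = 0 := hd.unique (hasDerivAt_const s 0)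
    have hs := congrArg ((N ^ k) *ᵥ ·) (h s)
    simpa only [mulVec_add, mulVec_mulVec, ← pow_succ, hz, zero_add, mulVec_zero] using hs
  have descend : ∀ k, (∀ s, (N ^ k) *ᵥ u s = 0) → ∀ s, u s = 0 := by
    intro k
    induction k with
    | zero => intro hk s; simpa using hk s
    | succ k ih => exact fun hk => ih (step k hk)
  exact descend μ (fun s => by rw [hN, zero_mulVec]) t

/-- For `N` with `N^μ = 0` and `g` of class `C^μ`, the function
`v(t) = Σ_{j=0}^{μ-1} (-1)^j N^j g^{(j)}(t)` is differentiable, solves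
`N·v'(t) + v(t) = g(t)` for all `t`, and is the unique differentiable solution. -/
theorem nilpotent_dae_unique_solution (n μ : ℕ) (hμ : 1 ≤ μ)
    (N : Matrix (Fin n) (Fin n) ℝ) (hN : N ^ μ = 0)
    (g : ℝ → Fin n → ℝ) (hg : ContDiff ℝ μ g)
    (v : ℝ → Fin n → ℝ)
    (hv : v = fun t => ∑ j ∈ Finset.range μ,
      ((-1 : ℝ) ^ j) • (N ^ j).mulVec (iteratedDeriv j g t)) :
    (Differentiable ℝ v ∧ ∀ t : ℝ, N.mulVec (deriv v t) + v t = g t) ∧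
    ∀ w : ℝ → Fin n → ℝ, Differentiable ℝ w →
      (∀ t : ℝ, N.mulVec (deriv w t) + w t = g t) → w = v := by
  have hderiv : ∀ t, HasDerivAt v (∑ j ∈ Finset.range μ,
      ((-1 : ℝ) ^ j) • (N ^ j) *ᵥ iteratedDeriv (j + 1) g t) t := by
    intro t
    rw [hv]
    refine HasDerivAt.fun_sum fun j hj => ?_
    have hd : Differentiable ℝ (iteratedDeriv j g) :=
      hg.differentiable_iteratedDeriv j (Nat.cast_lt.mpr (Finset.mem_range.mp hj))
    rw [iteratedDeriv_succ]
    exact ((hd t).hasDerivAt.const_mulVec (N ^ j)).const_smul ((-1 : ℝ) ^ j)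
  have hdiff : Differentiable ℝ v := fun t => (hderiv t).differentiableAt
  have hsol : ∀ t, N *ᵥ deriv v t + v t = g t := by
    intro t
    have htele := Finset.sum_range_sub'
      (fun j => ((-1 : ℝ) ^ j) • (N ^ j) *ᵥ iteratedDeriv j g t) μ
    simp only [hN, zero_mulVec, smul_zero, sub_zero, pow_zero, one_mulVec, one_smul,
      iteratedDeriv_zero] at htele
    rw [(hderiv t).deriv, hv, mulVec_sum, ← Finset.sum_add_distrib, ← htele]
    refine Finset.sum_congr rfl fun j _ => ?_
    rw [mulVec_smul, mulVec_mulVec, ← pow_succ', pow_succ (-1 : ℝ), mul_neg_one, neg_smul,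
      sub_neg_eq_add, add_comm]
  refine ⟨⟨hdiff, hsol⟩, fun w hw hwsol => funext fun t => sub_eq_zero.mp ?_⟩
  refine eq_zero_of_nilpotent_mulVec_deriv_add hN (hw.sub hdiff) (fun s => ?_) t
  rw [deriv_sub (hw s) (hdiff s), mulVec_sub, Pi.sub_apply, sub_add_sub_comm, hwsol, hsol, sub_self]
end

section
/- Let E, F be real m×m matrices forming a regular matrix pencil with Weierstraß–Kronecker decomposition (d, L, K, W, N), and let S_can be the associated canonical subspace. Then: (i) every differentiable function x : ℝ → ℝ^m satisfying E·x'(t) + F·x(t) = 0 for all t ∈ ℝ has x(t) ∈ S_can for all t ∈ ℝ; (ii) for every a ∈ ℝ and every x_a ∈ S_can there exists exactly one differentiable x : ℝ → ℝ^m with E·x'(t) + F·x(t) = 0 for all t and x(a) = x_a. -/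
open Matrix

variable {m : ℕ} {E F : Matrix (Fin m) (Fin m) ℝ}

/-- The index equivalence underlying `blockDiag`. -/
def WKDecomp.indexEquiv (w : WKDecomp m E F) : Fin w.d ⊕ Fin w.e ≃ Fin m :=
  finSumFinEquiv.trans (finCongr w.hde)

/-- The coordinates `(u, v)` of `x = K (u, v)`, with `u` the first `d` and `v` the last `m - d`
entries of `K⁻¹ x`. -/
noncomputable def WKDecomp.coords (w : WKDecomp m E F) :
    (Fin m → ℝ) ≃L[ℝ] (Fin w.d → ℝ) × (Fin w.e → ℝ) :=
  ((w.K.toLinearEquiv' ((isUnit_iff_isUnit_det _).2 w.hK).invertible).symm ≪≫ₗ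
    LinearEquiv.funCongrLeft ℝ ℝ w.indexEquiv ≪≫ₗ
    LinearEquiv.sumArrowLequivProdArrow _ _ ℝ ℝ).toContinuousLinearEquiv

theorem WKDecomp.coords_symm_apply (w : WKDecomp m E F)
    (p : (Fin w.d → ℝ) × (Fin w.e → ℝ)) :
    w.coords.symm p = w.K *ᵥ (Sum.elim p.1 p.2 ∘ w.indexEquiv.symm) := by
  rfl

theorem WKDecomp.blockDiag_mulVec (w : WKDecomp m E F) (A : Matrix (Fin w.d) (Fin w.d) ℝ)
    (B : Matrix (Fin w.e) (Fin w.e) ℝ) (u : Fin w.d → ℝ) (v : Fin w.e → ℝ) :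
    blockDiag w.hde A B *ᵥ (Sum.elim u v ∘ w.indexEquiv.symm) =
      Sum.elim (A *ᵥ u) (B *ᵥ v) ∘ w.indexEquiv.symm := by
  change (fromBlocks A 0 0 B).submatrix w.indexEquiv.symm w.indexEquiv.symm *ᵥ _ = _
  rw [submatrix_mulVec_equiv]
  simp [Function.comp_assoc, fromBlocks_mulVec]

/-- In canonical coordinates the equation `E x' + F x = 0` decouples into
`u' + W u = 0` and `N v' + v = 0`. -/
theorem WKDecomp.mulVec_add_mulVec_eq_zero_iff (w : WKDecomp m E F) (y x : Fin m → ℝ) :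
    E *ᵥ y + F *ᵥ x = 0 ↔
      (w.coords y).1 + w.W *ᵥ (w.coords x).1 = 0 ∧
        w.N *ᵥ (w.coords y).2 + (w.coords x).2 = 0 := by
  obtain ⟨p, rfl⟩ := w.coords.symm.surjective y
  obtain ⟨q, rfl⟩ := w.coords.symm.surjective x
  have hL : Function.Injective w.L.mulVec :=
    mulVec_injective_of_isUnit ((isUnit_iff_isUnit_det _).2 w.hL)
  rw [← hL.eq_iff, mulVec_zero, mulVec_add, ContinuousLinearEquiv.apply_symm_apply,
    ContinuousLinearEquiv.apply_symm_apply, w.coords_symm_apply, w.coords_symm_apply]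
  simp only [mulVec_mulVec, ← Matrix.mul_assoc, w.hE, w.hF, w.blockDiag_mulVec, one_mulVec]
  constructor
  · intro h
    constructor <;> ext i
    · simpa using congrFun h (w.indexEquiv (Sum.inl i))
    · simpa using congrFun h (w.indexEquiv (Sum.inr i))
  · rintro ⟨h₁, h₂⟩
    ext i
    obtain ⟨j | j, rfl⟩ := w.indexEquiv.surjective i
    · simpa using congrFun h₁ j
    · simpa using congrFun h₂ j

theorem WKDecomp.mem_Scan_iff (w : WKDecomp m E F) (x : Fin m → ℝ) :
    x ∈ w.Scan ↔ (w.coords x).2 = 0 := by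
  have hcol (u : Fin w.d → ℝ) : w.coords.symm (u, 0) =
      ∑ j, u j • w.K.transpose (finCongr w.hde (Fin.castAdd w.e j)) := by
    rw [w.coords_symm_apply, mulVec_eq_sum, ← w.indexEquiv.sum_comp, Fintype.sum_sum_type]
    simp [indexEquiv]
  constructor
  · intro h
    induction h using Submodule.span_induction with
    | mem x hx =>
      obtain ⟨j, rfl⟩ := hx
      have h := hcol (Pi.single j 1)
      simp only [Pi.single_apply, ite_smul, one_smul, zero_smul, Finset.sum_ite_eq',
        Finset.mem_univ, if_true] at h
      simp only [← h, ContinuousLinearEquiv.apply_symm_apply]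
    | zero => simp
    | add x y _ _ hx hy => simp [hx, hy]
    | smul a x _ hx => simp [hx]
  · intro h
    have hx : x = w.coords.symm ((w.coords x).1, 0) := by
      rw [← h, Prod.mk.eta, ContinuousLinearEquiv.symm_apply_apply]
    rw [hx, hcol]
    exact Submodule.sum_mem _ fun j _ =>
      Submodule.smul_mem _ _ (Submodule.subset_span ⟨j, rfl⟩)

/-- A differentiable solution of `N v' + v = 0` with `N` nilpotent vanishes. -/
theorem eq_zero_of_isNilpotent_of_mulVec_deriv_add {ι : Type*} [Fintype ι] [DecidableEq ι]
    {N : Matrix ι ι ℝ} (hN : IsNilpotent N) {v v' : ℝ → ι → ℝ}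
    (hv : ∀ t, HasDerivAt v (v' t) t) (h : ∀ t, N *ᵥ v' t + v t = 0) (t : ℝ) : v t = 0 := by
  obtain ⟨k, hk⟩ := hN
  have key : ∀ j ≤ k, ∀ t, (N ^ (k - j)) *ᵥ v t = 0 := by
    intro j
    induction j with
    | zero => simp [hk]
    | succ j ih =>
      intro hj t
      have hd : HasDerivAt (fun s => (N ^ (k - j)) *ᵥ v s) ((N ^ (k - j)) *ᵥ v' t) t :=
        (mulVecLin (N ^ (k - j))).toContinuousLinearMap.hasFDerivAt.comp_hasDerivAt t (hv t)
      rw [funext (ih (by omega))] at hd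
      have h0 := hd.unique (hasDerivAt_const t 0)
      have hmul := congrArg ((N ^ (k - (j + 1))) *ᵥ ·) (h t)
      rwa [mulVec_zero, mulVec_add, mulVec_mulVec, ← pow_succ,
        show k - (j + 1) + 1 = k - j by omega, h0, zero_add] at hmul
  simpa using key k le_rfl t

/-- The autonomous linear initial value problem `u' = T u`, `u a = u₀` is solvable on `ℝ`. -/
theorem exists_hasDerivAt_clm_apply {V : Type*} [NormedAddCommGroup V] [NormedSpace ℝ V]
    [CompleteSpace V] (T : V →L[ℝ] V) (a : ℝ) (u₀ : V) :
    ∃ u : ℝ → V, u a = u₀ ∧ ∀ t, HasDerivAt u (T (u t)) t := by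
  refine ⟨fun t => NormedSpace.exp ((t - a) • T) u₀, by simp, fun t => ?_⟩
  have h := (hasDerivAt_exp_smul_const' (𝕂 := ℝ) T (t - a)).comp_sub_const t a
  simpa using h.clm_apply (hasDerivAt_const t u₀)

/-- For a regular matrix pencil: (i) every differentiable solution of the homogeneous DAE
`E·x' + F·x = 0` stays in the canonical subspace `S_can`; (ii) through every point of `S_can`
at any time `a` there passes exactly one solution. -/
theorem flow_in_Scan_and_unique (m : ℕ) (E F : Matrix (Fin m) (Fin m) ℝ)
    (hreg : RegularPencil E F) (w : WKDecomp m E F) :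
    (∀ x : ℝ → Fin m → ℝ, Differentiable ℝ x →
      (∀ t : ℝ, E.mulVec (deriv x t) + F.mulVec (x t) = 0) →
      ∀ t : ℝ, x t ∈ w.Scan) ∧
    ∀ (a : ℝ) (xa : Fin m → ℝ), xa ∈ w.Scan →
      ∃! x : ℝ → Fin m → ℝ, Differentiable ℝ x ∧
        (∀ t : ℝ, E.mulVec (deriv x t) + F.mulVec (x t) = 0) ∧ x a = xa := by
  have hcoords {x : ℝ → Fin m → ℝ} (hx : Differentiable ℝ x) (t : ℝ) :
      HasDerivAt (fun s => w.coords (x s)) (w.coords (deriv x t)) t :=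
    w.coords.toContinuousLinearMap.hasFDerivAt.comp_hasDerivAt t (hx t).hasDerivAt
  have hsnd {x : ℝ → Fin m → ℝ} (hx : Differentiable ℝ x)
      (h : ∀ t, E.mulVec (deriv x t) + F.mulVec (x t) = 0) (t : ℝ) : (w.coords (x t)).2 = 0 :=
    eq_zero_of_isNilpotent_of_mulVec_deriv_add w.hN (fun t => (hcoords hx t).snd)
      (fun t => ((w.mulVec_add_mulVec_eq_zero_iff _ _).1 (h t)).2) t
  refine ⟨fun x hx h t => (w.mem_Scan_iff _).2 (hsnd hx h t), fun a xa hxa => ?_⟩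
  let T : (Fin w.d → ℝ) →L[ℝ] (Fin w.d → ℝ) := (mulVecLin (-w.W)).toContinuousLinearMap
  have hT (u : Fin w.d → ℝ) : T u = -(w.W *ᵥ u) := neg_mulVec u w.W
  have hfst {x : ℝ → Fin m → ℝ} (hx : Differentiable ℝ x)
      (h : ∀ t, E.mulVec (deriv x t) + F.mulVec (x t) = 0) (t : ℝ) :
      HasDerivAt (fun s => (w.coords (x s)).1) (T (w.coords (x t)).1) t := by
    rw [hT, ← eq_neg_of_add_eq_zero_left ((w.mulVec_add_mulVec_eq_zero_iff _ _).1 (h t)).1]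
    exact (hcoords hx t).fst
  refine existsUnique_of_exists_of_unique ?_ ?_
  · obtain ⟨u, hua, hu⟩ := exists_hasDerivAt_clm_apply T a (w.coords xa).1
    have hd (t : ℝ) : HasDerivAt (fun s => w.coords.symm (u s, 0))
        (w.coords.symm (T (u t), 0)) t :=
      w.coords.symm.toContinuousLinearMap.hasFDerivAt.comp_hasDerivAt t
        ((hu t).prodMk (hasDerivAt_const t 0))
    refine ⟨_, fun t => (hd t).differentiableAt, fun t => ?_, ?_⟩
    · rw [(hd t).deriv, w.mulVec_add_mulVec_eq_zero_iff]
      simp [hT]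
    · rw [hua, ← (w.mem_Scan_iff xa).1 hxa, Prod.mk.eta,
        ContinuousLinearEquiv.symm_apply_apply]
  · rintro x y ⟨hx, hxe, hxa⟩ ⟨hy, hye, hya⟩
    have hxy := ODE_solution_unique_univ (v := fun _ => T) (s := fun _ => Set.univ) (t₀ := a)
      (fun _ => T.lipschitz.lipschitzOnWith) (fun t => ⟨hfst hx hxe t, trivial⟩)
      (fun t => ⟨hfst hy hye t, trivial⟩) (by simp only [hxa, hya])
    ext1 t
    exact w.coords.injective
      (Prod.ext (congrFun hxy t) ((hsnd hx hxe t).trans (hsnd hy hye t).symm))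
end

section
/- Let E, F be real m×m matrices forming a regular matrix pencil with Weierstraß–Kronecker decomposition (d, L, K, W, N), where N^μ = 0, and let N_can be the associated canonical subspace. Let q : ℝ → ℝ^m be of class C^μ, let a ∈ ℝ and x_a ∈ ℝ^m be arbitrary. Then there exists exactly one differentiable function x : ℝ → ℝ^m such that E·x'(t) + F·x(t) = q(t) for all t ∈ ℝ and x(a) − x_a ∈ N_can. -/
open Matrix

variable {m : ℕ} {E F : Matrix (Fin m) (Fin m) ℝ}

section
variable {X Y U V : Type*} [NormedAddCommGroup X] [NormedSpace ℝ X]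
  [NormedAddCommGroup Y] [NormedSpace ℝ Y] [NormedAddCommGroup U] [NormedSpace ℝ U]
  [NormedAddCommGroup V] [NormedSpace ℝ V]

/-- Two solutions of `u' + A u = f` with the same initial value coincide. -/
theorem linear_ode_unique [CompleteSpace U] (A : U →L[ℝ] U) {f u₁ u₂ : ℝ → U} {a : ℝ}
    (h₁ : ∀ t, HasDerivAt u₁ (f t - A (u₁ t)) t) (h₂ : ∀ t, HasDerivAt u₂ (f t - A (u₂ t)) t)
    (ha : u₁ a = u₂ a) : u₁ = u₂ :=
  ODE_solution_unique_univ (v := fun t x => f t - A x) (s := fun _ => Set.univ) (K := ‖A‖₊)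
    (t₀ := a)
    (fun t => by
      refine LipschitzOnWith.of_dist_le_mul fun x _ y _ => ?_
      simpa [dist_eq_norm, norm_sub_rev] using A.le_opNorm (y - x))
    (fun t => ⟨h₁ t, trivial⟩) (fun t => ⟨h₂ t, trivial⟩) ha

/-- The linear initial value problem `u' + A u = f`, `u a = u₀` has a global solution. -/
theorem exists_linear_ode_solution [CompleteSpace U] (A : U →L[ℝ] U) {f : ℝ → U}
    (hf : Continuous f) (a : ℝ) (u₀ : U) :
    ∃ u : ℝ → U, u a = u₀ ∧ ∀ t, HasDerivAt u (f t - A (u t)) t := by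
  have hexp : Continuous fun t : ℝ => NormedSpace.exp (t • A) :=
    continuous_iff_continuousAt.2 fun t => (hasDerivAt_exp_smul_const A t).continuousAt
  have hg : Continuous fun s : ℝ => NormedSpace.exp ((s - a) • A) (f s) :=
    (hexp.comp (continuous_id.sub continuous_const)).clm_apply hf
  refine ⟨fun t => NormedSpace.exp ((a - t) • A)
    (u₀ + ∫ s in a..t, NormedSpace.exp ((s - a) • A) (f s)), by simp, fun t => ?_⟩
  have h1 : HasDerivAt (fun t : ℝ => NormedSpace.exp ((a - t) • A))
      (-(A * NormedSpace.exp ((a - t) • A))) t := by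
    have h := (hasDerivAt_exp_smul_const' A (a - t)).scomp t ((hasDerivAt_id t).const_sub a)
    rw [neg_one_smul] at h
    exact h
  have h2 := h1.clm_apply ((hg.integral_hasStrictDerivAt a t).hasDerivAt.const_add u₀)
  have h3 : NormedSpace.exp ((a - t) • A) * NormedSpace.exp ((t - a) • A) = 1 := by
    let := NormedAlgebra.restrictScalars ℚ ℝ (U →L[ℝ] U)
    rw [← NormedSpace.exp_add_of_commute (((Commute.refl A).smul_left _).smul_right _),
      ← add_smul]
    simp
  have h4 := DFunLike.congr_fun h3 (f t)
  simp only [mul_apply_eq_comp, one_apply_eq_self] at h4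
  convert h2 using 1
  rw [h4]
  simp [sub_eq_add_neg, add_comm]

/-- For nilpotent `N`, the homogeneous equation `N v' + v = 0` has only the trivial solution. -/
theorem eq_zero_of_nilpotent_ode {N : V →L[ℝ] V} {μ : ℕ} (hN : N ^ μ = 0) {v : ℝ → V}
    (hd : Differentiable ℝ v) (hv : ∀ t, N (deriv v t) + v t = 0) : v = 0 := by
  have key : ∀ k ≤ μ, ∀ t, (N ^ k) (v t) = 0 := by
    intro k hk
    induction hk using Nat.decreasingInduction with
    | self => simp [hN]
    | of_succ k _ ih =>
      intro t
      have h := ((N ^ (k + 1)).hasFDerivAt.comp_hasDerivAt t (hd t).hasDerivAt).deriv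
      rw [show (⇑(N ^ (k + 1)) ∘ v) = fun _ => 0 from funext ih, deriv_const] at h
      rw [eq_neg_of_add_eq_zero_right (hv t), map_neg, neg_eq_zero, h, pow_succ]
      rfl
  exact funext fun t => by simpa using key 0 (Nat.zero_le _) t

/-- For nilpotent `N` of index at most `μ` and `p` of class `C^μ`, the equation `N v' + v = p`
has a differentiable solution. -/
theorem exists_nilpotent_ode_solution {N : V →L[ℝ] V} {μ : ℕ} (hN : N ^ μ = 0) {p : ℝ → V}
    (hp : ContDiff ℝ μ p) :
    ∃ v : ℝ → V, Differentiable ℝ v ∧ ∀ t, N (deriv v t) + v t = p t := by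
  have hd : ∀ t, HasDerivAt (fun t => ∑ i ∈ Finset.range μ, ((-N) ^ i) (iteratedDeriv i p t))
      (∑ i ∈ Finset.range μ, ((-N) ^ i) (iteratedDeriv (i + 1) p t)) t := by
    intro t
    refine HasDerivAt.fun_sum fun i hi => ?_
    have h := (hp.differentiable_iteratedDeriv i
      (by exact_mod_cast Finset.mem_range.1 hi) t).hasDerivAt
    rw [← iteratedDeriv_succ] at h
    exact ((-N) ^ i).hasFDerivAt.comp_hasDerivAt t h
  refine ⟨_, fun t => (hd t).differentiableAt, fun t => ?_⟩
  have h1 : ∀ i, N (((-N) ^ i) (iteratedDeriv (i + 1) p t)) =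
      -((-N) ^ (i + 1)) (iteratedDeriv (i + 1) p t) := fun i => by
    rw [pow_succ']; simp
  rw [(hd t).deriv, map_sum, Finset.sum_congr rfl fun i _ => h1 i, Finset.sum_neg_distrib,
    neg_add_eq_sub, ← Finset.sum_sub_distrib,
    Finset.sum_range_sub' (fun i => ((-N) ^ i) (iteratedDeriv i p t)), neg_pow N μ, hN]
  simp

/-- The initial value problem for an operator pencil in Weierstraß–Kronecker form: if `E` and `F`
become `diag (1, N)` and `diag (W, 1)` in the coordinates given by `Φ` and `Ψ`, prescribing the
first component of `x a` singles out exactly one solution of `E x' + F x = q`. -/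
theorem existsUnique_of_kronecker_form [CompleteSpace U] {E F : X →L[ℝ] Y}
    (Φ : (U × V) ≃L[ℝ] X) (Ψ : (U × V) ≃L[ℝ] Y) {W : U →L[ℝ] U} {N : V →L[ℝ] V}
    (hE : ∀ z, E (Φ z) = Ψ (z.1, N z.2)) (hF : ∀ z, F (Φ z) = Ψ (W z.1, z.2))
    {μ : ℕ} (hN : N ^ μ = 0) {q : ℝ → Y} (hq : ContDiff ℝ μ q) (a : ℝ) (xa : X) :
    ∃! x : ℝ → X, Differentiable ℝ x ∧ (∀ t, E (deriv x t) + F (x t) = q t) ∧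
      (Φ.symm (x a - xa)).1 = 0 := by
  have hq' : ContDiff ℝ μ fun t => Ψ.symm (q t) := Ψ.symm.contDiff.comp hq
  have split : ∀ (z z' : U × V) (t : ℝ), E (Φ z') + F (Φ z) = q t ↔
      z'.1 = (Ψ.symm (q t)).1 - W z.1 ∧ N z'.2 + z.2 = (Ψ.symm (q t)).2 := by
    intro z z' t
    rw [hE, hF, ← map_add, ← Ψ.eq_symm_apply, Prod.ext_iff, eq_sub_iff_add_eq]
    rfl
  have comp : ∀ x : ℝ → X, Differentiable ℝ x → (∀ t, E (deriv x t) + F (x t) = q t) →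
      (∀ t, HasDerivAt (fun t => (Φ.symm (x t)).1)
        ((Ψ.symm (q t)).1 - W (Φ.symm (x t)).1) t) ∧
      Differentiable ℝ (fun t => (Φ.symm (x t)).2) ∧
      ∀ t, N (deriv (fun t => (Φ.symm (x t)).2) t) + (Φ.symm (x t)).2 = (Ψ.symm (q t)).2 := by
    intro x hx heq
    have hz : ∀ t, HasDerivAt (fun t => Φ.symm (x t)) (Φ.symm (deriv x t)) t := fun t =>
      (Φ.symm : X →L[ℝ] U × V).hasFDerivAt.comp_hasDerivAt t (hx t).hasDerivAt
    have hs := fun t => (split (Φ.symm (x t)) (Φ.symm (deriv x t)) t).1 (by simpa using heq t)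
    have h1 : ∀ t, HasDerivAt (fun t => (Φ.symm (x t)).1) (Φ.symm (deriv x t)).1 t := fun t =>
      (ContinuousLinearMap.fst ℝ U V).hasFDerivAt.comp_hasDerivAt t (hz t)
    have h2 : ∀ t, HasDerivAt (fun t => (Φ.symm (x t)).2) (Φ.symm (deriv x t)).2 t := fun t =>
      (ContinuousLinearMap.snd ℝ U V).hasFDerivAt.comp_hasDerivAt t (hz t)
    refine ⟨fun t => (hs t).1 ▸ h1 t, fun t => (h2 t).differentiableAt, fun t => ?_⟩
    rw [(h2 t).deriv]
    exact (hs t).2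
  obtain ⟨u, hua, hu⟩ := exists_linear_ode_solution W hq'.continuous.fst a (Φ.symm xa).1
  obtain ⟨v, hvd, hv⟩ := exists_nilpotent_ode_solution hN hq'.snd
  have hx : ∀ t, HasDerivAt (fun t => Φ (u t, v t))
      (Φ ((Ψ.symm (q t)).1 - W (u t), deriv v t)) t := fun t =>
    (Φ : U × V →L[ℝ] X).hasFDerivAt.comp_hasDerivAt t ((hu t).prodMk (hvd t).hasDerivAt)
  have hxeq : ∀ t, E (deriv (fun t => Φ (u t, v t)) t) + F (Φ (u t, v t)) = q t := fun t => by
    rw [(hx t).deriv, split]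
    exact ⟨rfl, hv t⟩
  refine ⟨fun t => Φ (u t, v t), ⟨fun t => (hx t).differentiableAt, hxeq, by simp [hua]⟩, ?_⟩
  rintro y ⟨hyd, hyeq, hya⟩
  obtain ⟨y1, y2d, y2⟩ := comp y hyd hyeq
  have e1 : (fun t => (Φ.symm (y t)).1) = u := by
    refine linear_ode_unique W y1 hu (a := a) ?_
    rw [map_sub, Prod.fst_sub, sub_eq_zero] at hya
    exact hya.trans hua.symm
  have e2 : (fun t => (Φ.symm (y t)).2) - v = 0 := by
    refine eq_zero_of_nilpotent_ode hN (y2d.sub hvd) fun t => ?_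
    rw [deriv_sub (y2d t) (hvd t), map_sub, Pi.sub_apply, sub_add_sub_comm, y2, hv, sub_self]
  funext t
  rw [← Φ.symm_apply_eq]
  exact Prod.ext (congrFun e1 t) (congrFun (sub_eq_zero.1 e2) t)

end

/-- Gluing of a vector in `ℝ^d` and a vector in `ℝ^e` to a vector in `ℝ^m`, where `d + e = m`. -/
def blockVec {d e m : ℕ} (h : d + e = m) :
    ((Fin d → ℝ) × (Fin e → ℝ)) ≃ₗ[ℝ] (Fin m → ℝ) :=
  (LinearEquiv.sumArrowLequivProdArrow (Fin d) (Fin e) ℝ ℝ).symm ≪≫ₗ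
    LinearEquiv.funCongrLeft ℝ ℝ (finSumFinEquiv.trans (finCongr h)).symm

theorem blockVec_apply {d e m : ℕ} (h : d + e = m) (z : (Fin d → ℝ) × (Fin e → ℝ)) :
    blockVec h z = Sum.elim z.1 z.2 ∘ (finSumFinEquiv.trans (finCongr h)).symm := rfl

theorem blockDiag_mulVec_blockVec {d e m : ℕ} (h : d + e = m) (A : Matrix (Fin d) (Fin d) ℝ)
    (B : Matrix (Fin e) (Fin e) ℝ) (z : (Fin d → ℝ) × (Fin e → ℝ)) :
    blockDiag h A B *ᵥ blockVec h z = blockVec h (A *ᵥ z.1, B *ᵥ z.2) := by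
  rw [blockVec_apply, blockVec_apply, _root_.blockDiag, reindex_apply, submatrix_mulVec_equiv,
    Function.comp_assoc, Equiv.symm_symm, Equiv.symm_comp_self, Function.comp_id,
    fromBlocks_mulVec]
  simp

/-- The coordinates on `ℝ^m` given by the columns of `K`. -/
noncomputable def WKDecomp.coord (w : WKDecomp m E F) :
    ((Fin w.d → ℝ) × (Fin w.e → ℝ)) ≃ₗ[ℝ] (Fin m → ℝ) :=
  blockVec w.hde ≪≫ₗ
    Matrix.toLin'OfInv (Matrix.nonsing_inv_mul w.K w.hK) (Matrix.mul_nonsing_inv w.K w.hK)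

/-- The coordinates on `ℝ^m` given by the columns of `L⁻¹`. -/
noncomputable def WKDecomp.coordRange (w : WKDecomp m E F) :
    ((Fin w.d → ℝ) × (Fin w.e → ℝ)) ≃ₗ[ℝ] (Fin m → ℝ) :=
  blockVec w.hde ≪≫ₗ
    Matrix.toLin'OfInv (Matrix.mul_nonsing_inv w.L w.hL) (Matrix.nonsing_inv_mul w.L w.hL)

theorem WKDecomp.coord_apply (w : WKDecomp m E F) (z : (Fin w.d → ℝ) × (Fin w.e → ℝ)) :
    w.coord z = w.K *ᵥ blockVec w.hde z := rfl

theorem WKDecomp.coordRange_apply (w : WKDecomp m E F) (z : (Fin w.d → ℝ) × (Fin w.e → ℝ)) :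
    w.coordRange z = w.L⁻¹ *ᵥ blockVec w.hde z := rfl

theorem WKDecomp.mulVec_coord (w : WKDecomp m E F) {G : Matrix (Fin m) (Fin m) ℝ}
    {A : Matrix (Fin w.d) (Fin w.d) ℝ} {B : Matrix (Fin w.e) (Fin w.e) ℝ}
    (hG : w.L * G * w.K = blockDiag w.hde A B) (z : (Fin w.d → ℝ) × (Fin w.e → ℝ)) :
    G *ᵥ w.coord z = w.coordRange (A *ᵥ z.1, B *ᵥ z.2) := by
  rw [coordRange_apply, ← blockDiag_mulVec_blockVec, ← hG, coord_apply, mulVec_mulVec,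
    mulVec_mulVec, mul_assoc w.L, nonsing_inv_mul_cancel_left _ _ w.hL]

theorem WKDecomp.coord_eq_sum (w : WKDecomp m E F) (z : (Fin w.d → ℝ) × (Fin w.e → ℝ)) :
    w.coord z = ∑ i, z.1 i • w.K.transpose (finCongr w.hde (Fin.castAdd w.e i)) +
      ∑ j, z.2 j • w.K.transpose (finCongr w.hde (Fin.natAdd w.d j)) := by
  rw [coord_apply, mulVec_eq_sum, ← (finSumFinEquiv.trans (finCongr w.hde)).sum_comp,
    Fintype.sum_sum_type]
  simp [blockVec_apply]

theorem WKDecomp.mem_Ncan_iff (w : WKDecomp m E F) (x : Fin m → ℝ) :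
    x ∈ w.Ncan ↔ (w.coord.symm x).1 = 0 := by
  obtain ⟨z, rfl⟩ := w.coord.surjective x
  rw [LinearEquiv.symm_apply_apply, Ncan, Submodule.mem_span_range_iff_exists_fun]
  have h : ∀ c : Fin w.e → ℝ,
      ∑ j, c j • w.K.transpose (finCongr w.hde (Fin.natAdd w.d j)) = w.coord (0, c) := fun c => by
    simp [coord_eq_sum]
  simp only [h, w.coord.injective.eq_iff]
  exact ⟨fun ⟨_, hc⟩ => hc ▸ rfl, fun hz => ⟨z.2, Prod.ext hz.symm rfl⟩⟩

/-- **Accurately stated initial conditions.** For a regular matrix pencil with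
Weierstraß–Kronecker decomposition where `N^μ = 0`, for every `C^μ` inhomogeneity `q`,
every `a ∈ ℝ` and every (not necessarily consistent) `x_a ∈ ℝ^m`, the IVP
`E·x' + F·x = q`, `x(a) - x_a ∈ N_can` has exactly one differentiable solution. -/
theorem ivp_accurate_initial_condition (m μ : ℕ) (E F : Matrix (Fin m) (Fin m) ℝ)
    (hreg : RegularPencil E F) (w : WKDecomp m E F) (hNμ : w.N ^ μ = 0)
    (q : ℝ → Fin m → ℝ) (hq : ContDiff ℝ μ q) (a : ℝ) (xa : Fin m → ℝ) :
    ∃! x : ℝ → Fin m → ℝ, Differentiable ℝ x ∧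
      (∀ t : ℝ, E.mulVec (deriv x t) + F.mulVec (x t) = q t) ∧
      x a - xa ∈ w.Ncan := by
  simp only [w.mem_Ncan_iff]
  refine existsUnique_of_kronecker_form (E := E.mulVecLin.toContinuousLinearMap)
    (F := F.mulVecLin.toContinuousLinearMap) w.coord.toContinuousLinearEquiv
    w.coordRange.toContinuousLinearEquiv (W := w.W.mulVecLin.toContinuousLinearMap)
    (N := w.N.mulVecLin.toContinuousLinearMap) (fun z => ?_) (fun z => ?_) ?_ hq a xa
  · simpa using w.mulVec_coord w.hE z
  · simpa using w.mulVec_coord w.hF z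
  · have h : w.N.mulVecLin ^ μ = 0 := by
      rw [← Matrix.toLin'_apply', ← Matrix.toLin'_pow, hNμ, map_zero]
    apply ContinuousLinearMap.coe_injective
    rw [ContinuousLinearMap.toLinearMap_pow]
    exact h
end

section
/- Let E, F, M be real m×m matrices and let L, K be invertible real m×m matrices. Define Ẽ := L·E·K and F̃ := L·F·K + L·E·M. Set N := ker E, S := {z ∈ ℝ^m : F·z ∈ range E}, Ñ := ker Ẽ, S̃ := {z ∈ ℝ^m : F̃·z ∈ range Ẽ}. Then Ñ = K⁻¹·N (the image of N under multiplication by K⁻¹), S̃ = K⁻¹·S, and Ñ ∩ S̃ = K⁻¹·(N ∩ S). In particular rank Ẽ = rank E and dim(Ñ ∩ S̃) = dim(N ∩ S). -/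
open Matrix

theorem Matrix.mem_map_mulVecLin_nonsing_inv {n R : Type*} [Fintype n] [DecidableEq n]
    [CommRing R] {K : Matrix n n R} (hK : IsUnit K.det) (U : Submodule R (n → R)) (z : n → R) :
    z ∈ Submodule.map (K⁻¹).mulVecLin U ↔ K *ᵥ z ∈ U := by
  constructor
  · rintro ⟨u, hu, rfl⟩
    simpa [Matrix.mul_nonsing_inv K hK] using hu
  · intro h
    exact ⟨K *ᵥ z, h, by simp [Matrix.nonsing_inv_mul K hK]⟩

theorem Matrix.mulVec_injective_of_isUnit_det {n R : Type*} [Fintype n] [DecidableEq n]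
    [CommRing R] {A : Matrix n n R} (hA : IsUnit A.det) : Function.Injective A.mulVec :=
  Matrix.mulVec_injective_of_isUnit ((Matrix.isUnit_iff_isUnit_det A).mpr hA)

/-- **Equivalence transformations preserve the basic subspaces.** For invertible `L, K` and
`Ẽ = L·E·K`, `F̃ = L·F·K + L·E·M`, one has `Ñ = K⁻¹·N`, `S̃ = K⁻¹·S`,
`Ñ ∩ S̃ = K⁻¹·(N ∩ S)`, and in particular `rank Ẽ = rank E` and
`dim (Ñ ∩ S̃) = dim (N ∩ S)`. -/
theorem equivalence_transformation_subspaces (m : ℕ)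
    (E F M L K : Matrix (Fin m) (Fin m) ℝ)
    (hL : IsUnit L.det) (hK : IsUnit K.det)
    (Et Ft : Matrix (Fin m) (Fin m) ℝ)
    (hEt : Et = L * E * K) (hFt : Ft = L * F * K + L * E * M)
    (N S Nt St : Submodule ℝ (Fin m → ℝ))
    (hN : N = LinearMap.ker E.mulVecLin)
    (hS : S = Submodule.comap F.mulVecLin (LinearMap.range E.mulVecLin))
    (hNt : Nt = LinearMap.ker Et.mulVecLin)
    (hSt : St = Submodule.comap Ft.mulVecLin (LinearMap.range Et.mulVecLin)) :
    Nt = Submodule.map (K⁻¹).mulVecLin N ∧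
    St = Submodule.map (K⁻¹).mulVecLin S ∧
    Nt ⊓ St = Submodule.map (K⁻¹).mulVecLin (N ⊓ S) ∧
    Et.rank = E.rank ∧
    Module.finrank ℝ (Nt ⊓ St : Submodule ℝ (Fin m → ℝ))
      = Module.finrank ℝ (N ⊓ S : Submodule ℝ (Fin m → ℝ)) := by
  have hker : Nt = Submodule.map (K⁻¹).mulVecLin N := by
    ext z
    rw [Matrix.mem_map_mulVecLin_nonsing_inv hK, hNt, hN, hEt]
    simp only [LinearMap.mem_ker, Matrix.mulVecLin_apply, ← Matrix.mulVec_mulVec]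
    rw [← (Matrix.mulVec_injective_of_isUnit_det hL).eq_iff (a := E *ᵥ K *ᵥ z),
      Matrix.mulVec_zero]
  have hcomap : St = Submodule.map (K⁻¹).mulVecLin S := by
    ext z
    rw [Matrix.mem_map_mulVecLin_nonsing_inv hK, hSt, hS, hEt, hFt]
    simp only [Submodule.mem_comap, LinearMap.mem_range, Matrix.mulVecLin_apply,
      Matrix.add_mulVec, ← Matrix.mulVec_mulVec, ← Matrix.mulVec_add]
    constructor
    · rintro ⟨y, hy⟩
      refine ⟨K *ᵥ y - M *ᵥ z, ?_⟩
      rw [Matrix.mulVec_sub, Matrix.mulVec_injective_of_isUnit_det hL hy, add_sub_cancel_right]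
    · rintro ⟨y, hy⟩
      refine ⟨K⁻¹ *ᵥ (y + M *ᵥ z), ?_⟩
      rw [Matrix.mulVec_mulVec _ K, Matrix.mul_nonsing_inv K hK, Matrix.one_mulVec,
        Matrix.mulVec_add E, hy]
  have hinf : Nt ⊓ St = Submodule.map (K⁻¹).mulVecLin (N ⊓ S) := by
    ext z
    rw [hker, hcomap, Submodule.mem_inf]
    simp only [Matrix.mem_map_mulVecLin_nonsing_inv hK, Submodule.mem_inf]
  refine ⟨hker, hcomap, hinf, ?_, ?_⟩
  · rw [hEt, Matrix.rank_mul_eq_left_of_isUnit_det K _ hK,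
      Matrix.rank_mul_eq_right_of_isUnit_det L _ hL]
  · rw [hinf]
    exact (Submodule.equivMapOfInjective (K⁻¹).mulVecLin
      (Matrix.mulVec_injective_of_isUnit_det (Matrix.isUnit_nonsing_inv_det K hK))
      (N ⊓ S)).finrank_eq.symm
end

section
/- Define E : ℝ → ℝ^{2×2} by E(t) = [[−t, t²], [−1, t]]. Let x = (x₁, x₂) : ℝ → ℝ² be differentiable. Then x satisfies E(t)·x'(t) + x(t) = 0 for all t ∈ ℝ if and only if x₁(t) = t·x₂(t) for all t ∈ ℝ. In particular, for every differentiable function α : ℝ → ℝ the function x(t) = α(t)·(t, 1) is a solution, so the solution set of the homogeneous DAE is an infinite-dimensional family. -/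
open Matrix

/-- The two scalar equations of the Griepentrog–März DAE. -/
lemma griepentrog_maerz_residual_eq_zero_iff (t : ℝ) (v w : Fin 2 → ℝ) :
    (!![-t, t ^ 2; -1, t] : Matrix (Fin 2) (Fin 2) ℝ).mulVec v + w = 0 ↔
      -t * v 0 + t ^ 2 * v 1 + w 0 = 0 ∧ -v 0 + t * v 1 + w 1 = 0 := by
  simp [funext_iff, Fin.forall_fin_two, vecHead, vecTail]

/-- **The Griepentrog–März example.** For `E(t) = [[-t, t²], [-1, t]]` and `F = I₂`, a
differentiable `x : ℝ → ℝ²` solves the homogeneous DAE `E(t)·x'(t) + x(t) = 0` iff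
`x₁(t) = t·x₂(t)` for all `t`; in particular for every differentiable `α : ℝ → ℝ` the
function `x(t) = α(t)·(t,1)` is a solution, so the solution set is an infinite family. -/
theorem griepentrog_maerz_example
    (E : ℝ → Matrix (Fin 2) (Fin 2) ℝ)
    (hE : E = fun t => !![-t, t ^ 2; -1, t]) :
    (∀ x : ℝ → Fin 2 → ℝ, Differentiable ℝ x →
      ((∀ t : ℝ, (E t).mulVec (deriv x t) + x t = 0) ↔ ∀ t : ℝ, x t 0 = t * x t 1)) ∧
    (∀ α : ℝ → ℝ, Differentiable ℝ α →
      ∀ t : ℝ, (E t).mulVec (deriv (fun s => α s • ![s, 1]) t)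
        + α t • ![t, 1] = 0) := by
  have key : ∀ x : ℝ → Fin 2 → ℝ, Differentiable ℝ x →
      ((∀ t : ℝ, (E t).mulVec (deriv x t) + x t = 0) ↔ ∀ t : ℝ, x t 0 = t * x t 1) := by
    intro x hx
    subst hE
    simp only [griepentrog_maerz_residual_eq_zero_iff]
    refine ⟨fun h t => by linear_combination (h t).1 - t * (h t).2, fun h t => ?_⟩
    have hd : ∀ i, HasDerivAt (fun s => x s i) (deriv x t i) t :=
      hasDerivAt_pi.1 (hx t).hasDerivAt
    have h0 : HasDerivAt (fun s => x s 0) (1 * x t 1 + t * deriv x t 1) t := by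
      rw [funext h]
      exact (hasDerivAt_id t).mul (hd 1)
    have h1 := (hd 0).unique h0
    exact ⟨by linear_combination h t - t * h1, by linear_combination -h1⟩
  refine ⟨key, fun α hα => (key (fun s => α s • ![s, 1]) ?_).2 fun t => ?_⟩
  · refine hα.smul (differentiable_pi.2 fun i => ?_)
    fin_cases i
    · exact differentiable_id
    · exact differentiable_const 1
  · simp [mul_comm]
end

section
/- Let E, F be real m×m matrices forming a regular matrix pencil with Weierstraß–Kronecker decomposition (d, L, K, W, N), and let N_can be the associated canonical subspace (span of the last m−d columns of K). Let C_* be any real m×d matrix whose columns form a basis of the span of the first d columns of Lᵀ. Then {z ∈ ℝ^m : C_*ᵀ·E·z = 0} = N_can. -/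
open Matrix

variable {m : ℕ} {E F : Matrix (Fin m) (Fin m) ℝ}

theorem forall_dotProduct_eq_zero_iff_span {ι n R : Type*} [Fintype n] [CommSemiring R]
    (f : ι → n → R) (z : n → R) :
    (∀ i, f i ⬝ᵥ z = 0) ↔ ∀ v ∈ Submodule.span R (Set.range f), v ⬝ᵥ z = 0 := by
  refine ⟨fun h v hv => ?_, fun h i => h _ (Submodule.subset_span ⟨i, rfl⟩)⟩
  induction hv using Submodule.span_induction with
  | mem x hx => obtain ⟨i, rfl⟩ := hx; exact h i
  | zero => exact zero_dotProduct z
  | add x y _ _ hx hy => rw [add_dotProduct, hx, hy, add_zero]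
  | smul a x _ hx => rw [smul_dotProduct, hx, smul_zero]

theorem blockDiag_one_mulVec_castAdd {d e m : ℕ} (h : d + e = m)
    (B : Matrix (Fin e) (Fin e) ℝ) (y : Fin m → ℝ) (j : Fin d) :
    (blockDiag h 1 B *ᵥ y) (finCongr h (Fin.castAdd e j)) =
      y (finCongr h (Fin.castAdd e j)) := by
  subst h
  simp [_root_.blockDiag, mulVec, dotProduct, Fin.sum_univ_add, one_apply]

theorem mulVec_mem_span_natAdd {d e m : ℕ} (h : d + e = m) (K : Matrix (Fin m) (Fin m) ℝ)
    (y : Fin m → ℝ) (hy : ∀ j, y (finCongr h (Fin.castAdd e j)) = 0) :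
    K *ᵥ y ∈ Submodule.span ℝ (Set.range fun j => Kᵀ (finCongr h (Fin.natAdd d j))) := by
  subst h
  rw [mulVec_eq_sum, Fin.sum_univ_add]
  refine add_mem (sum_mem fun i _ => ?_) (sum_mem fun i _ => ?_)
  · have hi : y (Fin.castAdd e i) = 0 := hy i
    simp [hi]
  · rw [op_smul_eq_smul]
    exact Submodule.smul_mem _ _ (Submodule.subset_span ⟨i, rfl⟩)

/-- `N_can` is the kernel of the first `d` rows of `L * E`. -/
theorem WKDecomp.mem_Ncan_iff_s17 (w : WKDecomp m E F) (z : Fin m → ℝ) :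
    z ∈ w.Ncan ↔ ∀ j : Fin w.d,
      w.L (finCongr w.hde (Fin.castAdd w.e j)) ⬝ᵥ (E *ᵥ z) = 0 := by
  have key (y : Fin m → ℝ) (j : Fin w.d) :
      w.L (finCongr w.hde (Fin.castAdd w.e j)) ⬝ᵥ (E *ᵥ (w.K *ᵥ y)) =
        y (finCongr w.hde (Fin.castAdd w.e j)) := by
    rw [← blockDiag_one_mulVec_castAdd w.hde w.N y j, ← w.hE, ← mulVec_mulVec, ← mulVec_mulVec]
    rfl
  constructor
  · intro hz j
    induction hz using Submodule.span_induction with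
    | mem x hx =>
      obtain ⟨i, rfl⟩ := hx
      have hcol : w.K.transpose (finCongr w.hde (Fin.natAdd w.d i)) =
          w.K *ᵥ Pi.single (finCongr w.hde (Fin.natAdd w.d i)) 1 := by
        rw [mulVec_single_one]; rfl
      simp only [hcol, key]
      refine Pi.single_eq_of_ne (fun hij => ?_) _
      have := congrArg Fin.val hij
      simp at this
      omega
    | zero => simp
    | add x y _ _ hx hy => rw [mulVec_add, dotProduct_add, hx, hy, add_zero]
    | smul a x _ hx => rw [mulVec_smul, dotProduct_smul, hx, smul_zero]
  · intro hz
    have hzK : w.K *ᵥ (w.K⁻¹ *ᵥ z) = z := by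
      rw [mulVec_mulVec, mul_nonsing_inv _ w.hK, one_mulVec]
    rw [← hzK] at hz ⊢
    exact mulVec_mem_span_natAdd w.hde w.K _ fun j => (key _ j).symm.trans (hz j)

/-- **Accurate initial conditions via the adjoint pencil (constant-coefficient version of
Theorem t.ker).** If the columns of `C_*` form a basis of the span of the first `d` columns
of `Lᵀ` (the canonical flow subspace of the adjoint pair), then
`{z : C_*ᵀ·E·z = 0} = N_can`. -/
theorem Ncan_eq_ker_adjoint_basis (m : ℕ) (E F : Matrix (Fin m) (Fin m) ℝ)
    (hreg : RegularPencil E F) (w : WKDecomp m E F)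
    (Cs : Matrix (Fin m) (Fin w.d) ℝ)
    (hCsind : LinearIndependent ℝ fun j : Fin w.d => Cs.transpose j)
    (hCsspan : Submodule.span ℝ (Set.range fun j : Fin w.d => Cs.transpose j)
      = Submodule.span ℝ
          (Set.range fun j : Fin w.d =>
            w.L.transpose.transpose (finCongr w.hde (Fin.castAdd w.e j)))) :
    LinearMap.ker (Cs.transpose * E).mulVecLin = w.Ncan := by
  ext z
  rw [w.mem_Ncan_iff_s17, LinearMap.mem_ker, mulVecLin_apply, ← mulVec_mulVec, funext_iff]
  exact (forall_dotProduct_eq_zero_iff_span (fun j => Cs.transpose j) _).trans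
    (hCsspan ▸ (forall_dotProduct_eq_zero_iff_span _ _).symm)
end
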